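/- Larson–Sweedler theorem (unital case): Under the standing hypotheses in the context, if there are a faithful set of left integrals and a faithful set of right integrals, then there exist a counit ε : A → ℂ (i.e. (ε ⊗ id)(Δ(a)·(1 ⊗ b)) = a b and (id ⊗ ε)((a ⊗ 1)·Δ(b)) = a b for all a, b ∈ A) and a bijective linear map S : A → A such that: S(a a') = S(a') S(a) for all a, a' ∈ A; Δ(S(a)) = τ((S ⊗ S)(Δ(a))) for all a ∈ A, where τ : A ⊗ A → A ⊗ A is the tensor flip; and, writing m : A ⊗ A → A for the multiplication map, m((S ⊗ id)(Δ(a))) = (id ⊗ ε)((1 ⊗ a)·E) and m((id ⊗ S)(Δ(a))) = (ε ⊗ id)(E·(a ⊗ 1)) for all a ∈ A. In other words, (A, Δ) is a regular weak Hopf algebra with antipode S. -/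

import Mathlib

open TensorProduct

/-- Slice map `id ⊗ ω` landing in the left tensor factor. -/
noncomputable def sL {B C : Type} [AddCommGroup B] [Module ℂ B] [AddCommGroup C] [Module ℂ C]
    (ω : C →ₗ[ℂ] ℂ) : (B ⊗[ℂ] C) →ₗ[ℂ] B :=
  (TensorProduct.rid ℂ B).toLinearMap ∘ₗ LinearMap.lTensor B ω

/-- Slice map `ω ⊗ id` landing in the right tensor factor. -/
noncomputable def sR {B C : Type} [AddCommGroup B] [Module ℂ B] [AddCommGroup C] [Module ℂ C]
    (ω : B →ₗ[ℂ] ℂ) : (B ⊗[ℂ] C) →ₗ[ℂ] C :=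
  (TensorProduct.lid ℂ C).toLinearMap ∘ₗ LinearMap.rTensor C ω

/-- `u ⊗ v ↦ u ⊗ (v ⊗ 1)`, placing `A ⊗ A` in legs 1 and 2 of the triple tensor product. -/
noncomputable def leg12 (A : Type) [Ring A] [Algebra ℂ A] :
    (A ⊗[ℂ] A) →ₗ[ℂ] A ⊗[ℂ] (A ⊗[ℂ] A) :=
  TensorProduct.map LinearMap.id ((TensorProduct.mk ℂ A A).flip 1)

/-- `u ⊗ v ↦ u ⊗ (1 ⊗ v)`, placing `A ⊗ A` in legs 1 and 3 of the triple tensor product. -/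
noncomputable def leg13 (A : Type) [Ring A] [Algebra ℂ A] :
    (A ⊗[ℂ] A) →ₗ[ℂ] A ⊗[ℂ] (A ⊗[ℂ] A) :=
  TensorProduct.map LinearMap.id (TensorProduct.mk ℂ A A 1)

/-- A left integral: a nonzero functional with `(id ⊗ φ)(Δ a) ∈ C` for all `a`. -/
noncomputable def IsLeftIntegral (A : Type) [Ring A] [Algebra ℂ A] (Δ : A →ₗ[ℂ] A ⊗[ℂ] A)
    (C : Subalgebra ℂ A) (φ : A →ₗ[ℂ] ℂ) : Prop :=
  φ ≠ 0 ∧ ∀ a : A, sL φ (Δ a) ∈ C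

/-- A right integral: a nonzero functional with `(ψ ⊗ id)(Δ a) ∈ B` for all `a`. -/
noncomputable def IsRightIntegral (A : Type) [Ring A] [Algebra ℂ A] (Δ : A →ₗ[ℂ] A ⊗[ℂ] A)
    (B : Subalgebra ℂ A) (ψ : A →ₗ[ℂ] ℂ) : Prop :=
  ψ ≠ 0 ∧ ∀ a : A, sR ψ (Δ a) ∈ B

/-- There is a faithful set of left integrals. -/
noncomputable def FaithfulLeftIntegrals (A : Type) [Ring A] [Algebra ℂ A]
    (Δ : A →ₗ[ℂ] A ⊗[ℂ] A) (C : Subalgebra ℂ A) : Prop :=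
  (∀ a : A, (∀ φ : A →ₗ[ℂ] ℂ, IsLeftIntegral A Δ C φ → ∀ b : A, φ (a * b) = 0) → a = 0) ∧
  (∀ a : A, (∀ φ : A →ₗ[ℂ] ℂ, IsLeftIntegral A Δ C φ → ∀ b : A, φ (b * a) = 0) → a = 0)

/-- There is a faithful set of right integrals. -/
noncomputable def FaithfulRightIntegrals (A : Type) [Ring A] [Algebra ℂ A]
    (Δ : A →ₗ[ℂ] A ⊗[ℂ] A) (B : Subalgebra ℂ A) : Prop :=
  (∀ a : A, (∀ ψ : A →ₗ[ℂ] ℂ, IsRightIntegral A Δ B ψ → ∀ b : A, ψ (a * b) = 0) → a = 0) ∧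
  (∀ a : A, (∀ ψ : A →ₗ[ℂ] ℂ, IsRightIntegral A Δ B ψ → ∀ b : A, ψ (b * a) = 0) → a = 0)

section Slices

variable {V W : Type} [AddCommGroup V] [Module ℂ V] [AddCommGroup W] [Module ℂ W]

@[simp] theorem sL_tmul (ω : W →ₗ[ℂ] ℂ) (v : V) (w : W) :
    sL ω (v ⊗ₜ[ℂ] w) = ω w • v := by
  simp [sL]

@[simp] theorem sR_tmul (ω : V →ₗ[ℂ] ℂ) (v : V) (w : W) :
    sR ω (v ⊗ₜ[ℂ] w) = ω v • w := by
  simp [sR]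

theorem apply_sL_eq_apply_sR (θ : V →ₗ[ℂ] ℂ) (ω : W →ₗ[ℂ] ℂ) (w : V ⊗[ℂ] W) :
    θ (sL ω w) = ω (sR θ w) := by
  induction w using TensorProduct.induction_on with
  | zero => simp
  | tmul u v => simp [mul_comm]
  | add x y hx hy => simp [hx, hy]

theorem eq_zero_of_forall_sL (w : V ⊗[ℂ] W) (h : ∀ ω : W →ₗ[ℂ] ℂ, sL ω w = 0) : w = 0 := by
  classical
  let b := Module.Basis.ofVectorSpace ℂ W
  have key : ∀ (w : V ⊗[ℂ] W) i,
      TensorProduct.equivFinsuppOfBasisRight b w i = sL (b.coord i) w := by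
    intro w i
    induction w using TensorProduct.induction_on with
    | zero => simp
    | tmul u v => simp
    | add x y hx hy => simp [hx, hy]
  apply (TensorProduct.equivFinsuppOfBasisRight (M := V) b).injective
  ext i
  rw [key, h, map_zero, Finsupp.zero_apply]

theorem eq_zero_of_separating_sR {Ω : Set (V →ₗ[ℂ] ℂ)}
    (hΩ : ∀ v : V, (∀ ω ∈ Ω, ω v = 0) → v = 0) (w : V ⊗[ℂ] W)
    (h : ∀ ω ∈ Ω, sR ω w = 0) : w = 0 := by
  refine eq_zero_of_forall_sL w fun η => hΩ _ fun ω hω => ?_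
  rw [apply_sL_eq_apply_sR, h ω hω, map_zero]

theorem eq_zero_of_separating_sL {Ω : Set (W →ₗ[ℂ] ℂ)}
    (hΩ : ∀ v : W, (∀ ω ∈ Ω, ω v = 0) → v = 0) (w : V ⊗[ℂ] W)
    (h : ∀ ω ∈ Ω, sL ω w = 0) : w = 0 := by
  refine eq_zero_of_forall_sL w fun η => ?_
  refine (Module.forall_dual_apply_eq_zero_iff ℂ _).1 fun θ => ?_
  have : sR θ w = 0 := hΩ _ fun ω hω => by
    rw [← apply_sL_eq_apply_sR, h ω hω, map_zero]
  rw [apply_sL_eq_apply_sR, this, map_zero]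

theorem sR_lTensor {U : Type} [AddCommGroup U] [Module ℂ U] (ω : V →ₗ[ℂ] ℂ)
    (g : W →ₗ[ℂ] U) (w : V ⊗[ℂ] W) : sR ω (LinearMap.lTensor V g w) = g (sR ω w) := by
  induction w using TensorProduct.induction_on with
  | zero => simp
  | tmul u v => simp
  | add x y hx hy => simp [hx, hy]

theorem sL_rTensor {U : Type} [AddCommGroup U] [Module ℂ U] (ω : W →ₗ[ℂ] ℂ)
    (g : V →ₗ[ℂ] U) (w : V ⊗[ℂ] W) : sL ω (LinearMap.rTensor W g w) = g (sL ω w) := by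
  induction w using TensorProduct.induction_on with
  | zero => simp
  | tmul u v => simp
  | add x y hx hy => simp [hx, hy]

theorem lTensor_sum_smulRight {U ι : Type} [AddCommGroup U] [Module ℂ U] [Fintype ι]
    (ω : ι → W →ₗ[ℂ] ℂ) (c : ι → U) (w : V ⊗[ℂ] W) :
    LinearMap.lTensor V (∑ i, (ω i).smulRight (c i)) w = ∑ i, sL (ω i) w ⊗ₜ[ℂ] c i := by
  induction w using TensorProduct.induction_on with
  | zero => simp
  | tmul u v => simp [TensorProduct.smul_tmul', TensorProduct.tmul_sum]
  | add x y hx hy => simp [TensorProduct.add_tmul, Finset.sum_add_distrib, hx, hy]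

theorem rTensor_sum_smulRight {U ι : Type} [AddCommGroup U] [Module ℂ U] [Fintype ι]
    (ω : ι → V →ₗ[ℂ] ℂ) (c : ι → U) (w : V ⊗[ℂ] W) :
    LinearMap.rTensor W (∑ i, (ω i).smulRight (c i)) w = ∑ i, c i ⊗ₜ[ℂ] sR (ω i) w := by
  induction w using TensorProduct.induction_on with
  | zero => simp
  | tmul u v => simp [TensorProduct.smul_tmul, TensorProduct.sum_tmul]
  | add x y hx hy => simp [TensorProduct.tmul_add, Finset.sum_add_distrib, hx, hy]

end Slices

section SliceMul

variable {A : Type} [Ring A] [Algebra ℂ A]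

theorem sL_mul_tmul_one {R : Type} [Ring R] [Algebra ℂ R] (ω : A →ₗ[ℂ] ℂ) (w : R ⊗[ℂ] A)
    (a : R) : sL ω (w * a ⊗ₜ[ℂ] (1 : A)) = sL ω w * a := by
  induction w using TensorProduct.induction_on with
  | zero => simp
  | tmul u v => simp
  | add x y hx hy => simp [add_mul, hx, hy]

theorem sL_tmul_one_mul (ω : A →ₗ[ℂ] ℂ) (w : A ⊗[ℂ] A) (a : A) :
    sL ω (a ⊗ₜ[ℂ] (1 : A) * w) = a * sL ω w := by
  induction w using TensorProduct.induction_on with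
  | zero => simp
  | tmul u v => simp
  | add x y hx hy => simp [mul_add, hx, hy]

theorem sR_mul_one_tmul (ω : A →ₗ[ℂ] ℂ) (w : A ⊗[ℂ] A) (a : A) :
    sR ω (w * (1 : A) ⊗ₜ[ℂ] a) = sR ω w * a := by
  induction w using TensorProduct.induction_on with
  | zero => simp
  | tmul u v => simp
  | add x y hx hy => simp [add_mul, hx, hy]

theorem sR_one_tmul_mul (ω : A →ₗ[ℂ] ℂ) (w : A ⊗[ℂ] A) (a : A) :
    sR ω ((1 : A) ⊗ₜ[ℂ] a * w) = a * sR ω w := by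
  induction w using TensorProduct.induction_on with
  | zero => simp
  | tmul u v => simp
  | add x y hx hy => simp [mul_add, hx, hy]

theorem sL_mul_one_tmul {R : Type} [Ring R] [Algebra ℂ R] (ω : A →ₗ[ℂ] ℂ) (w : R ⊗[ℂ] A)
    (a : A) : sL ω (w * (1 : R) ⊗ₜ[ℂ] a) = sL (ω ∘ₗ LinearMap.mulRight ℂ a) w := by
  induction w using TensorProduct.induction_on with
  | zero => simp
  | tmul u v => simp
  | add x y hx hy => simp [add_mul, hx, hy]

theorem sL_one_tmul_mul (ω : A →ₗ[ℂ] ℂ) (w : A ⊗[ℂ] A) (a : A) :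
    sL ω ((1 : A) ⊗ₜ[ℂ] a * w) = sL (ω ∘ₗ LinearMap.mulLeft ℂ a) w := by
  induction w using TensorProduct.induction_on with
  | zero => simp
  | tmul u v => simp
  | add x y hx hy => simp [mul_add, hx, hy]

theorem sR_mul_tmul_one (ω : A →ₗ[ℂ] ℂ) (w : A ⊗[ℂ] A) (a : A) :
    sR ω (w * a ⊗ₜ[ℂ] (1 : A)) = sR (ω ∘ₗ LinearMap.mulRight ℂ a) w := by
  induction w using TensorProduct.induction_on with
  | zero => simp
  | tmul u v => simp
  | add x y hx hy => simp [add_mul, hx, hy]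

theorem sR_tmul_one_mul (ω : A →ₗ[ℂ] ℂ) (w : A ⊗[ℂ] A) (a : A) :
    sR ω (a ⊗ₜ[ℂ] (1 : A) * w) = sR (ω ∘ₗ LinearMap.mulLeft ℂ a) w := by
  induction w using TensorProduct.induction_on with
  | zero => simp
  | tmul u v => simp
  | add x y hx hy => simp [mul_add, hx, hy]

end SliceMul

/-- An algebra with a coassociative multiplicative `Δ` for which `Δ 1 = ∑ eᵢ ⊗ fᵢ` is a regular
separability idempotent in `B ⊗ C`, together with faithful sets of integrals. -/
structure SeparableComul {A : Type} [Ring A] [Algebra ℂ A] (Δ : A →ₗ[ℂ] A ⊗[ℂ] A)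
    {B C : Subalgebra ℂ A} (SB : B ≃ₗ[ℂ] C) (SC : C ≃ₗ[ℂ] B) {n : ℕ}
    (e : Fin n → B) (f : Fin n → C) : Prop where
  mul : ∀ a a' : A, Δ (a * a') = Δ a * Δ a'
  coassoc : ∀ a : A,
    TensorProduct.assoc ℂ A A A (LinearMap.rTensor A Δ (Δ a)) = LinearMap.lTensor A Δ (Δ a)
  fullL : Submodule.span ℂ {x : A | ∃ ω : A →ₗ[ℂ] ℂ, ∃ a : A, x = sL ω (Δ a)} = ⊤
  fullR : Submodule.span ℂ {x : A | ∃ ω : A →ₗ[ℂ] ℂ, ∃ a : A, x = sR ω (Δ a)} = ⊤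
  one : Δ 1 = ∑ i, (e i : A) ⊗ₜ[ℂ] (f i : A)
  one_mul_left : ∀ b : B, Δ 1 * (b : A) ⊗ₜ[ℂ] (1 : A) = Δ 1 * (1 : A) ⊗ₜ[ℂ] (SB b : A)
  right_mul_one : ∀ c : C, (1 : A) ⊗ₜ[ℂ] (c : A) * Δ 1 = (SC c : A) ⊗ₜ[ℂ] (1 : A) * Δ 1
  map_B : ∀ b ∈ B, Δ b = (1 : A) ⊗ₜ[ℂ] b * Δ 1
  map_B' : ∀ b ∈ B, Δ b = Δ 1 * (1 : A) ⊗ₜ[ℂ] b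
  map_C : ∀ c ∈ C, Δ c = c ⊗ₜ[ℂ] (1 : A) * Δ 1
  map_C' : ∀ c ∈ C, Δ c = Δ 1 * c ⊗ₜ[ℂ] (1 : A)
  exists_dual : ∃ θ : A →ₗ[ℂ] ℂ, ∑ i, θ (f i) • (SC.symm (e i) : A) = 1
  faithfulL : FaithfulLeftIntegrals A Δ C
  faithfulR : FaithfulRightIntegrals A Δ B

/-- The canonical map `a ⊗ b ↦ Δ(a)(1 ⊗ b)`. -/
noncomputable def galoisMap {A : Type} [Ring A] [Algebra ℂ A] (Δ : A →ₗ[ℂ] A ⊗[ℂ] A) :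
    A ⊗[ℂ] A →ₗ[ℂ] A ⊗[ℂ] A :=
  LinearMap.lTensor A (LinearMap.mul' ℂ A) ∘ₗ (TensorProduct.assoc ℂ A A A).toLinearMap ∘ₗ
    LinearMap.rTensor A Δ

/-- The canonical map `a ⊗ b ↦ (1 ⊗ b)Δ(a)`. -/
noncomputable def galoisMapOp {A : Type} [Ring A] [Algebra ℂ A] (Δ : A →ₗ[ℂ] A ⊗[ℂ] A) :
    A ⊗[ℂ] A →ₗ[ℂ] A ⊗[ℂ] A :=
  LinearMap.lTensor A (LinearMap.mul' ℂ A ∘ₗ (TensorProduct.comm ℂ A A).toLinearMap) ∘ₗ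
    (TensorProduct.assoc ℂ A A A).toLinearMap ∘ₗ LinearMap.rTensor A Δ

/-- The map `a ⊗ b ↦ ∑ a S_B⁻¹(fᵢ) ⊗ eᵢ b`. -/
noncomputable def galoisProj {A : Type} [Ring A] [Algebra ℂ A] {B C : Subalgebra ℂ A} {n : ℕ}
    (SB : B ≃ₗ[ℂ] C) (e : Fin n → B) (f : Fin n → C) : A ⊗[ℂ] A →ₗ[ℂ] A ⊗[ℂ] A :=
  ∑ i, TensorProduct.map (LinearMap.mulRight ℂ (SB.symm (f i) : A))
    (LinearMap.mulLeft ℂ (e i : A))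

/-- The map `a ⊗ b ↦ ∑ S_C(fᵢ) a ⊗ b eᵢ`. -/
noncomputable def galoisProjOp {A : Type} [Ring A] [Algebra ℂ A] {B C : Subalgebra ℂ A} {n : ℕ}
    (SC : C ≃ₗ[ℂ] B) (e : Fin n → B) (f : Fin n → C) : A ⊗[ℂ] A →ₗ[ℂ] A ⊗[ℂ] A :=
  ∑ i, TensorProduct.map (LinearMap.mulLeft ℂ (SC (f i) : A))
    (LinearMap.mulRight ℂ (e i : A))

section Galois

variable {A : Type} [Ring A] [Algebra ℂ A] (Δ : A →ₗ[ℂ] A ⊗[ℂ] A)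

@[simp] theorem galoisMap_tmul (a b : A) :
    galoisMap Δ (a ⊗ₜ[ℂ] b) = Δ a * (1 : A) ⊗ₜ[ℂ] b := by
  simp only [galoisMap, LinearMap.comp_apply, LinearMap.rTensor_tmul, LinearEquiv.coe_coe]
  induction Δ a using TensorProduct.induction_on with
  | zero => simp
  | tmul u v => simp
  | add x y hx hy => simp [add_mul, TensorProduct.add_tmul, hx, hy]

@[simp] theorem galoisMapOp_tmul (a b : A) :
    galoisMapOp Δ (a ⊗ₜ[ℂ] b) = (1 : A) ⊗ₜ[ℂ] b * Δ a := by
  simp only [galoisMapOp, LinearMap.comp_apply, LinearMap.rTensor_tmul, LinearEquiv.coe_coe]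
  induction Δ a using TensorProduct.induction_on with
  | zero => simp
  | tmul u v => simp
  | add x y hx hy => simp [mul_add, TensorProduct.add_tmul, hx, hy]

theorem galoisMap_mul_one_tmul (w : A ⊗[ℂ] A) (b : A) :
    galoisMap Δ (w * (1 : A) ⊗ₜ[ℂ] b) = galoisMap Δ w * (1 : A) ⊗ₜ[ℂ] b := by
  induction w using TensorProduct.induction_on with
  | zero => simp
  | tmul u v => simp [mul_assoc]
  | add x y hx hy => simp [add_mul, hx, hy]

/-- The pairing `(u ⊗ v, p ⊗ q) ↦ u ⊗ p ⊗ v q` followed by `φ` on the last leg. -/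
theorem galoisMap_slice (φ : A →ₗ[ℂ] ℂ) (w w' : A ⊗[ℂ] A) :
    galoisMap Δ (LinearMap.lTensor A (sL φ) (leg13 A w * (1 : A) ⊗ₜ[ℂ] w')) =
      LinearMap.lTensor A (sL φ)
        (TensorProduct.assoc ℂ A A A (LinearMap.rTensor A Δ w) * (1 : A) ⊗ₜ[ℂ] w') := by
  induction w using TensorProduct.induction_on with
  | zero => simp
  | add x y hx hy => simp [add_mul, hx, hy]
  | tmul u v =>
    induction w' using TensorProduct.induction_on with
    | zero => simp
    | add x y hx hy => simp [mul_add, TensorProduct.tmul_add, hx, hy]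
    | tmul p q =>
      simp only [leg13, TensorProduct.map_tmul, LinearMap.id_apply, TensorProduct.mk_apply,
        Algebra.TensorProduct.tmul_mul_tmul, LinearMap.lTensor_tmul, sL_tmul, one_mul, mul_one,
        TensorProduct.tmul_smul, map_smul, galoisMap_tmul, LinearMap.rTensor_tmul]
      induction Δ u using TensorProduct.induction_on with
      | zero => simp
      | add x y hx hy => simp [add_mul, TensorProduct.add_tmul, hx, hy]
      | tmul r s => simp

theorem galoisMapOp_slice (φ : A →ₗ[ℂ] ℂ) (w w' : A ⊗[ℂ] A) :
    galoisMapOp Δ (LinearMap.lTensor A (sL φ) ((1 : A) ⊗ₜ[ℂ] w' * leg13 A w)) =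
      LinearMap.lTensor A (sL φ)
        ((1 : A) ⊗ₜ[ℂ] w' * TensorProduct.assoc ℂ A A A (LinearMap.rTensor A Δ w)) := by
  induction w using TensorProduct.induction_on with
  | zero => simp
  | add x y hx hy => simp [mul_add, hx, hy]
  | tmul u v =>
    induction w' using TensorProduct.induction_on with
    | zero => simp
    | add x y hx hy => simp [add_mul, TensorProduct.tmul_add, hx, hy]
    | tmul p q =>
      simp only [leg13, TensorProduct.map_tmul, LinearMap.id_apply, TensorProduct.mk_apply,
        Algebra.TensorProduct.tmul_mul_tmul, LinearMap.lTensor_tmul, sL_tmul, one_mul, mul_one,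
        TensorProduct.tmul_smul, map_smul, galoisMapOp_tmul, LinearMap.rTensor_tmul]
      induction Δ u using TensorProduct.induction_on with
      | zero => simp
      | add x y hx hy => simp [mul_add, TensorProduct.add_tmul, hx, hy]
      | tmul r s => simp

theorem lTensor_sL_assoc_rTensor (ω : A →ₗ[ℂ] ℂ) (w : A ⊗[ℂ] A) :
    LinearMap.lTensor A (sL ω) (TensorProduct.assoc ℂ A A A (LinearMap.rTensor A Δ w)) =
      Δ (sL ω w) := by
  induction w using TensorProduct.induction_on with
  | zero => simp
  | add x y hx hy => simp [hx, hy]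
  | tmul u v =>
    simp only [sL_tmul, map_smul, LinearMap.rTensor_tmul]
    induction Δ u using TensorProduct.induction_on with
    | zero => simp
    | add x y hx hy => simp [TensorProduct.add_tmul, hx, hy]
    | tmul r s => simp

theorem rTensor_sR_assoc_symm_lTensor (ω : A →ₗ[ℂ] ℂ) (w : A ⊗[ℂ] A) :
    LinearMap.rTensor A (sR ω)
      ((TensorProduct.assoc ℂ A A A).symm (LinearMap.lTensor A Δ w)) = Δ (sR ω w) := by
  induction w using TensorProduct.induction_on with
  | zero => simp
  | add x y hx hy => simp [hx, hy]
  | tmul u v =>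
    simp only [sR_tmul, map_smul, LinearMap.lTensor_tmul]
    induction Δ v using TensorProduct.induction_on with
    | zero => simp
    | add x y hx hy => simp [TensorProduct.tmul_add, hx, hy]
    | tmul r s => simp [TensorProduct.smul_tmul']

/-- `Δ(a₁ ω(a₂)) = a₁ ⊗ a₂ ω(a₃)`. -/
theorem comul_sL (ω : A →ₗ[ℂ] ℂ)
    (hΔ : ∀ a, TensorProduct.assoc ℂ A A A (LinearMap.rTensor A Δ (Δ a)) =
      LinearMap.lTensor A Δ (Δ a)) (a : A) :
    Δ (sL ω (Δ a)) = LinearMap.lTensor A (sL ω ∘ₗ Δ) (Δ a) := by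
  rw [← lTensor_sL_assoc_rTensor, hΔ, LinearMap.lTensor_comp_apply]

/-- `Δ(ω(a₁) a₂) = ω(a₁) a₂ ⊗ a₃`. -/
theorem comul_sR (ω : A →ₗ[ℂ] ℂ)
    (hΔ : ∀ a, TensorProduct.assoc ℂ A A A (LinearMap.rTensor A Δ (Δ a)) =
      LinearMap.lTensor A Δ (Δ a)) (a : A) :
    Δ (sR ω (Δ a)) = LinearMap.rTensor A (sR ω ∘ₗ Δ) (Δ a) := by
  rw [← rTensor_sR_assoc_symm_lTensor, ← hΔ, LinearEquiv.symm_apply_apply,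
    LinearMap.rTensor_comp_apply]

end Galois

namespace SeparableComul

variable {A : Type} [Ring A] [Algebra ℂ A] {Δ : A →ₗ[ℂ] A ⊗[ℂ] A}
  {B C : Subalgebra ℂ A} {SB : B ≃ₗ[ℂ] C} {SC : C ≃ₗ[ℂ] B} {n : ℕ}
  {e : Fin n → B} {f : Fin n → C} (D : SeparableComul Δ SB SC e f)

include D

theorem mul_one_comul (a : A) : Δ a * Δ 1 = Δ a := by
  rw [← D.mul, mul_one]

theorem one_comul_mul (a : A) : Δ 1 * Δ a = Δ a := by
  rw [← D.mul, one_mul]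

theorem comul_mul_left (a : A) (b : B) :
    Δ a * (b : A) ⊗ₜ[ℂ] (1 : A) = Δ a * (1 : A) ⊗ₜ[ℂ] (SB b : A) := by
  rw [← D.mul_one_comul, mul_assoc, mul_assoc, D.one_mul_left]

theorem comul_mul_right (a : A) (c : C) :
    Δ a * (1 : A) ⊗ₜ[ℂ] (c : A) = Δ a * (SB.symm c : A) ⊗ₜ[ℂ] (1 : A) := by
  rw [D.comul_mul_left, LinearEquiv.apply_symm_apply]

theorem right_mul_comul (a : A) (c : C) :
    (1 : A) ⊗ₜ[ℂ] (c : A) * Δ a = (SC c : A) ⊗ₜ[ℂ] (1 : A) * Δ a := by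
  rw [← D.one_comul_mul, ← mul_assoc, ← mul_assoc, D.right_mul_one]

theorem left_mul_comul (a : A) (b : B) :
    (b : A) ⊗ₜ[ℂ] (1 : A) * Δ a = (1 : A) ⊗ₜ[ℂ] (SC.symm b : A) * Δ a := by
  rw [D.right_mul_comul, LinearEquiv.apply_symm_apply]

theorem ext_of_lTensor {M : Type} [AddCommGroup M] [Module ℂ M] {g h : A →ₗ[ℂ] M}
    (H : ∀ a, LinearMap.lTensor A g (Δ a) = LinearMap.lTensor A h (Δ a)) : g = h := by
  refine LinearMap.ext_on D.fullR ?_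
  rintro _ ⟨ω, a, rfl⟩
  rw [← sR_lTensor, H, sR_lTensor]

theorem ext_of_rTensor {M : Type} [AddCommGroup M] [Module ℂ M] {g h : A →ₗ[ℂ] M}
    (H : ∀ a, LinearMap.rTensor A g (Δ a) = LinearMap.rTensor A h (Δ a)) : g = h := by
  refine LinearMap.ext_on D.fullL ?_
  rintro _ ⟨ω, a, rfl⟩
  rw [← sL_rTensor, H, sL_rTensor]

theorem leftIntegral_eq_right {φ : A →ₗ[ℂ] ℂ} (hφ : IsLeftIntegral A Δ C φ) (x : A) :
    sL φ (Δ x) = ∑ i, φ (x * SB (e i)) • (f i : A) := by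
  have key : sL φ ∘ₗ Δ =
      ∑ i, (φ ∘ₗ LinearMap.mulRight ℂ (SB (e i) : A)).smulRight (f i : A) := by
    refine D.ext_of_lTensor fun a => ?_
    rw [← comul_sL Δ φ D.coassoc, D.map_C _ (hφ.2 a), D.one, Finset.mul_sum,
      lTensor_sum_smulRight]
    refine Finset.sum_congr rfl fun i _ => ?_
    rw [← sL_mul_one_tmul, ← D.comul_mul_left, sL_mul_tmul_one]
    simp
  simpa using congrArg (· x) key

theorem leftIntegral_eq_left {φ : A →ₗ[ℂ] ℂ} (hφ : IsLeftIntegral A Δ C φ) (x : A) :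
    sL φ (Δ x) = ∑ i, φ (SC.symm (e i) * x) • (f i : A) := by
  have key : sL φ ∘ₗ Δ =
      ∑ i, (φ ∘ₗ LinearMap.mulLeft ℂ (SC.symm (e i) : A)).smulRight (f i : A) := by
    refine D.ext_of_lTensor fun a => ?_
    rw [← comul_sL Δ φ D.coassoc, D.map_C' _ (hφ.2 a), D.one, Finset.sum_mul,
      lTensor_sum_smulRight]
    refine Finset.sum_congr rfl fun i _ => ?_
    rw [← sL_one_tmul_mul, ← D.left_mul_comul, sL_tmul_one_mul]
    simp
  simpa using congrArg (· x) key

theorem rightIntegral_eq_right {ψ : A →ₗ[ℂ] ℂ} (hψ : IsRightIntegral A Δ B ψ) (x : A) :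
    sR ψ (Δ x) = ∑ i, ψ (x * SB.symm (f i)) • (e i : A) := by
  have key : sR ψ ∘ₗ Δ =
      ∑ i, (ψ ∘ₗ LinearMap.mulRight ℂ (SB.symm (f i) : A)).smulRight (e i : A) := by
    refine D.ext_of_rTensor fun a => ?_
    rw [← comul_sR Δ ψ D.coassoc, D.map_B _ (hψ.2 a), D.one, Finset.mul_sum,
      rTensor_sum_smulRight]
    refine Finset.sum_congr rfl fun i _ => ?_
    rw [← sR_mul_tmul_one, ← D.comul_mul_right, sR_mul_one_tmul]
    simp
  simpa using congrArg (· x) key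

theorem rightIntegral_eq_left {ψ : A →ₗ[ℂ] ℂ} (hψ : IsRightIntegral A Δ B ψ) (x : A) :
    sR ψ (Δ x) = ∑ i, ψ (SC (f i) * x) • (e i : A) := by
  have key : sR ψ ∘ₗ Δ =
      ∑ i, (ψ ∘ₗ LinearMap.mulLeft ℂ (SC (f i) : A)).smulRight (e i : A) := by
    refine D.ext_of_rTensor fun a => ?_
    rw [← comul_sR Δ ψ D.coassoc, D.map_B' _ (hψ.2 a), D.one, Finset.sum_mul,
      rTensor_sum_smulRight]
    refine Finset.sum_congr rfl fun i _ => ?_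
    rw [← sR_tmul_one_mul, ← D.right_mul_comul, sR_one_tmul_mul]
    simp
  simpa using congrArg (· x) key

theorem span_slices_mulRight : Submodule.span ℂ {x : A | ∃ φ : A →ₗ[ℂ] ℂ,
    IsLeftIntegral A Δ C φ ∧ ∃ a b : A, x = sL (φ ∘ₗ LinearMap.mulRight ℂ b) (Δ a)} = ⊤ := by
  by_contra hV
  obtain ⟨θ, hθ, hker⟩ := Submodule.exists_le_ker_of_lt_top _ (lt_top_iff_ne_top.2 hV)
  refine hθ (LinearMap.ext_on D.fullL ?_)
  rintro _ ⟨ω, a, rfl⟩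
  have : sR θ (Δ a) = 0 := D.faithfulL.1 _ fun φ hφ b => by
    have h := hker (Submodule.subset_span ⟨φ, hφ, a, b, rfl⟩)
    rw [LinearMap.mem_ker, apply_sL_eq_apply_sR] at h
    exact h
  rw [apply_sL_eq_apply_sR, this, map_zero, LinearMap.zero_apply]

theorem span_slices_mulLeft : Submodule.span ℂ {x : A | ∃ φ : A →ₗ[ℂ] ℂ,
    IsLeftIntegral A Δ C φ ∧ ∃ a b : A, x = sL (φ ∘ₗ LinearMap.mulLeft ℂ a) (Δ b)} = ⊤ := by
  by_contra hV
  obtain ⟨θ, hθ, hker⟩ := Submodule.exists_le_ker_of_lt_top _ (lt_top_iff_ne_top.2 hV)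
  refine hθ (LinearMap.ext_on D.fullL ?_)
  rintro _ ⟨ω, b, rfl⟩
  have : sR θ (Δ b) = 0 := D.faithfulL.2 _ fun φ hφ a => by
    have h := hker (Submodule.subset_span ⟨φ, hφ, a, b, rfl⟩)
    rw [LinearMap.mem_ker, apply_sL_eq_apply_sR] at h
    exact h
  rw [apply_sL_eq_apply_sR, this, map_zero, LinearMap.zero_apply]

theorem galoisProj_eq_zero {w : A ⊗[ℂ] A} (hw : galoisMap Δ w = 0) :
    galoisProj SB e f w = 0 := by
  have key : ∀ ψ : A →ₗ[ℂ] ℂ, IsRightIntegral A Δ B ψ → ∀ (x : A) (w : A ⊗[ℂ] A),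
      sR ψ (Δ x * galoisMap Δ w) = sR (ψ ∘ₗ LinearMap.mulLeft ℂ x) (galoisProj SB e f w) := by
    intro ψ hψ x w
    induction w using TensorProduct.induction_on with
    | zero => simp
    | add u v hu hv => simp [mul_add, hu, hv]
    | tmul a b =>
      rw [galoisMap_tmul, ← mul_assoc, ← D.mul, sR_mul_one_tmul, D.rightIntegral_eq_right hψ]
      simp [galoisProj, Finset.sum_mul, mul_assoc]
  refine eq_zero_of_separating_sR (Ω := {ω | ∃ ψ : A →ₗ[ℂ] ℂ, IsRightIntegral A Δ B ψ ∧
    ∃ x, ω = ψ ∘ₗ LinearMap.mulLeft ℂ x}) (fun v hv => D.faithfulR.2 v fun ψ hψ x =>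
      hv _ ⟨ψ, hψ, x, rfl⟩) _ ?_
  rintro _ ⟨ψ, hψ, x, rfl⟩
  rw [← key ψ hψ, hw, mul_zero, map_zero]

theorem galoisProjOp_eq_zero {w : A ⊗[ℂ] A} (hw : galoisMapOp Δ w = 0) :
    galoisProjOp SC e f w = 0 := by
  have key : ∀ ψ : A →ₗ[ℂ] ℂ, IsRightIntegral A Δ B ψ → ∀ (x : A) (w : A ⊗[ℂ] A),
      sR ψ (galoisMapOp Δ w * Δ x) =
        sR (ψ ∘ₗ LinearMap.mulRight ℂ x) (galoisProjOp SC e f w) := by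
    intro ψ hψ x w
    induction w using TensorProduct.induction_on with
    | zero => simp
    | add u v hu hv => simp [add_mul, hu, hv]
    | tmul a b =>
      rw [galoisMapOp_tmul, mul_assoc, ← D.mul, sR_one_tmul_mul, D.rightIntegral_eq_left hψ]
      simp [galoisProjOp, Finset.mul_sum, mul_assoc]
  refine eq_zero_of_separating_sR (Ω := {ω | ∃ ψ : A →ₗ[ℂ] ℂ, IsRightIntegral A Δ B ψ ∧
    ∃ x, ω = ψ ∘ₗ LinearMap.mulRight ℂ x}) (fun v hv => D.faithfulR.1 v fun ψ hψ x =>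
      hv _ ⟨ψ, hψ, x, rfl⟩) _ ?_
  rintro _ ⟨ψ, hψ, x, rfl⟩
  rw [← key ψ hψ, hw, zero_mul, map_zero]

theorem galois_unique {w w' : A ⊗[ℂ] A} (h : galoisMap Δ w = galoisMap Δ w')
    (hw : galoisProj SB e f w = w) : w = galoisProj SB e f w' := by
  have := D.galoisProj_eq_zero (w := w - w') (by rw [map_sub, h, sub_self])
  rw [map_sub, hw, sub_eq_zero] at this
  exact this

theorem galoisOp_unique {w w' : A ⊗[ℂ] A} (h : galoisMapOp Δ w = galoisMapOp Δ w')
    (hw : galoisProjOp SC e f w = w) : w = galoisProjOp SC e f w' := by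
  have := D.galoisProjOp_eq_zero (w := w - w') (by rw [map_sub, h, sub_self])
  rw [map_sub, hw, sub_eq_zero] at this
  exact this

theorem galoisMap_slice_comul {φ : A →ₗ[ℂ] ℂ} (hφ : IsLeftIntegral A Δ C φ) (a b : A) :
    galoisMap Δ (LinearMap.lTensor A (sL φ) (leg13 A (Δ a) * (1 : A) ⊗ₜ[ℂ] Δ b)) =
      Δ 1 * sL (φ ∘ₗ LinearMap.mulRight ℂ b) (Δ a) ⊗ₜ[ℂ] (1 : A) := by
  have h1 : ∀ w : A ⊗[ℂ] A,
      LinearMap.lTensor A (sL φ) (LinearMap.lTensor A Δ w * (1 : A) ⊗ₜ[ℂ] Δ b) =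
      LinearMap.lTensor A (sL φ ∘ₗ Δ ∘ₗ LinearMap.mulRight ℂ b) w := by
    intro w
    induction w using TensorProduct.induction_on with
    | zero => simp
    | tmul u v => simp [D.mul]
    | add x y hx hy => simp [add_mul, hx, hy]
  have h2 : sL φ ∘ₗ Δ ∘ₗ LinearMap.mulRight ℂ b =
      ∑ i, (φ ∘ₗ LinearMap.mulRight ℂ b ∘ₗ
        LinearMap.mulLeft ℂ (SC.symm (e i) : A)).smulRight (f i : A) := by
    ext x
    simp [D.leftIntegral_eq_left hφ, mul_assoc]
  rw [galoisMap_slice, D.coassoc, h1, h2, lTensor_sum_smulRight, D.one, Finset.sum_mul]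
  refine Finset.sum_congr rfl fun i _ => ?_
  rw [← LinearMap.comp_assoc, ← sL_one_tmul_mul, ← D.left_mul_comul, sL_tmul_one_mul]
  simp

theorem galoisMapOp_slice_comul {φ : A →ₗ[ℂ] ℂ} (hφ : IsLeftIntegral A Δ C φ) (a b : A) :
    galoisMapOp Δ (LinearMap.lTensor A (sL φ) ((1 : A) ⊗ₜ[ℂ] Δ a * leg13 A (Δ b))) =
      sL (φ ∘ₗ LinearMap.mulLeft ℂ a) (Δ b) ⊗ₜ[ℂ] (1 : A) * Δ 1 := by
  have h1 : ∀ w : A ⊗[ℂ] A,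
      LinearMap.lTensor A (sL φ) ((1 : A) ⊗ₜ[ℂ] Δ a * LinearMap.lTensor A Δ w) =
      LinearMap.lTensor A (sL φ ∘ₗ Δ ∘ₗ LinearMap.mulLeft ℂ a) w := by
    intro w
    induction w using TensorProduct.induction_on with
    | zero => simp
    | tmul u v => simp [D.mul]
    | add x y hx hy => simp [mul_add, hx, hy]
  have h2 : sL φ ∘ₗ Δ ∘ₗ LinearMap.mulLeft ℂ a =
      ∑ i, (φ ∘ₗ LinearMap.mulLeft ℂ a ∘ₗ
        LinearMap.mulRight ℂ (SB (e i) : A)).smulRight (f i : A) := by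
    ext x
    simp [D.leftIntegral_eq_right hφ, mul_assoc]
  rw [galoisMapOp_slice, D.coassoc, h1, h2, lTensor_sum_smulRight, D.one, Finset.mul_sum]
  refine Finset.sum_congr rfl fun i _ => ?_
  rw [← LinearMap.comp_assoc, ← sL_mul_one_tmul, ← D.comul_mul_left, sL_mul_tmul_one]
  simp

theorem galoisProj_slice (φ : A →ₗ[ℂ] ℂ) (a b : A) :
    galoisProj SB e f
        (LinearMap.lTensor A (sL φ) (leg13 A (Δ a) * (1 : A) ⊗ₜ[ℂ] Δ b)) =
      LinearMap.lTensor A (sL φ) (leg13 A (Δ a) * (1 : A) ⊗ₜ[ℂ] Δ b) := by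
  have h : ∀ (i : Fin n) (w w' : A ⊗[ℂ] A),
      TensorProduct.map (LinearMap.mulRight ℂ (SB.symm (f i) : A))
        (LinearMap.mulLeft ℂ (e i : A))
        (LinearMap.lTensor A (sL φ) (leg13 A w * (1 : A) ⊗ₜ[ℂ] w')) =
      LinearMap.lTensor A (sL φ) (leg13 A (w * (SB.symm (f i) : A) ⊗ₜ[ℂ] (1 : A)) *
        (1 : A) ⊗ₜ[ℂ] ((e i : A) ⊗ₜ[ℂ] (1 : A) * w')) := by
    intro i w w'
    induction w using TensorProduct.induction_on with
    | zero => simp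
    | add x y hx hy => simp [add_mul, hx, hy]
    | tmul u v =>
      induction w' using TensorProduct.induction_on with
      | zero => simp
      | add x y hx hy => simp [mul_add, TensorProduct.tmul_add, hx, hy]
      | tmul p q => simp [leg13]
  have h' : ∀ (c d : A) (w w' : A ⊗[ℂ] A),
      leg13 A (w * (1 : A) ⊗ₜ[ℂ] c) * (1 : A) ⊗ₜ[ℂ] (d ⊗ₜ[ℂ] (1 : A) * w') =
      leg13 A w * (1 : A) ⊗ₜ[ℂ] (d ⊗ₜ[ℂ] c * w') := by
    intro c d w w'
    induction w using TensorProduct.induction_on with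
    | zero => simp
    | add x y hx hy => simp [add_mul, hx, hy]
    | tmul u v =>
      induction w' using TensorProduct.induction_on with
      | zero => simp
      | add x y hx hy => simp only [mul_add, TensorProduct.tmul_add, hx, hy]
      | tmul p q => simp [leg13, mul_assoc]
  have h'' : LinearMap.lTensor A (sL φ) (leg13 A (Δ a) * (1 : A) ⊗ₜ[ℂ] Δ b) =
      ∑ i, LinearMap.lTensor A (sL φ)
        (leg13 A (Δ a) * (1 : A) ⊗ₜ[ℂ] (((e i : A) ⊗ₜ[ℂ] (f i : A)) * Δ b)) := by
    rw [← map_sum, ← Finset.mul_sum, ← TensorProduct.tmul_sum, ← Finset.sum_mul, ← D.one,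
      D.one_comul_mul]
  rw [galoisProj, LinearMap.sum_apply, h'']
  refine Finset.sum_congr rfl fun i _ => ?_
  rw [← h'', h, ← D.comul_mul_right, h']

theorem galoisProjOp_slice (φ : A →ₗ[ℂ] ℂ) (a b : A) :
    galoisProjOp SC e f
        (LinearMap.lTensor A (sL φ) ((1 : A) ⊗ₜ[ℂ] Δ a * leg13 A (Δ b))) =
      LinearMap.lTensor A (sL φ) ((1 : A) ⊗ₜ[ℂ] Δ a * leg13 A (Δ b)) := by
  have h : ∀ (i : Fin n) (w w' : A ⊗[ℂ] A),
      TensorProduct.map (LinearMap.mulLeft ℂ (SC (f i) : A))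
        (LinearMap.mulRight ℂ (e i : A))
        (LinearMap.lTensor A (sL φ) ((1 : A) ⊗ₜ[ℂ] w' * leg13 A w)) =
      LinearMap.lTensor A (sL φ) ((1 : A) ⊗ₜ[ℂ] (w' * (e i : A) ⊗ₜ[ℂ] (1 : A)) *
        leg13 A ((SC (f i) : A) ⊗ₜ[ℂ] (1 : A) * w)) := by
    intro i w w'
    induction w using TensorProduct.induction_on with
    | zero => simp
    | add x y hx hy => simp [mul_add, hx, hy]
    | tmul u v =>
      induction w' using TensorProduct.induction_on with
      | zero => simp
      | add x y hx hy => simp [add_mul, TensorProduct.tmul_add, hx, hy]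
      | tmul p q => simp [leg13]
  have h' : ∀ (c d : A) (w w' : A ⊗[ℂ] A),
      (1 : A) ⊗ₜ[ℂ] (w' * d ⊗ₜ[ℂ] (1 : A)) * leg13 A ((1 : A) ⊗ₜ[ℂ] c * w) =
      (1 : A) ⊗ₜ[ℂ] (w' * d ⊗ₜ[ℂ] c) * leg13 A w := by
    intro c d w w'
    induction w using TensorProduct.induction_on with
    | zero => simp
    | add x y hx hy => simp [mul_add, hx, hy]
    | tmul u v =>
      induction w' using TensorProduct.induction_on with
      | zero => simp
      | add x y hx hy => simp only [add_mul, TensorProduct.tmul_add, hx, hy]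
      | tmul p q => simp [leg13, mul_assoc]
  have h'' : LinearMap.lTensor A (sL φ) ((1 : A) ⊗ₜ[ℂ] Δ a * leg13 A (Δ b)) =
      ∑ i, LinearMap.lTensor A (sL φ)
        ((1 : A) ⊗ₜ[ℂ] (Δ a * ((e i : A) ⊗ₜ[ℂ] (f i : A))) * leg13 A (Δ b)) := by
    rw [← map_sum, ← Finset.sum_mul, ← TensorProduct.tmul_sum, ← Finset.mul_sum, ← D.one,
      D.mul_one_comul]
  rw [galoisProjOp, LinearMap.sum_apply, h'']
  refine Finset.sum_congr rfl fun i _ => ?_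
  rw [← h'', h, ← D.right_mul_comul, h']

theorem exists_galoisInv : ∃ P : A →ₗ[ℂ] A ⊗[ℂ] A,
    (∀ x, galoisMap Δ (P x) = Δ 1 * x ⊗ₜ[ℂ] (1 : A)) ∧
    (∀ x, galoisProj SB e f (P x) = P x) ∧
    ∀ φ, IsLeftIntegral A Δ C φ → ∀ a b, P (sL (φ ∘ₗ LinearMap.mulRight ℂ b) (Δ a)) =
      LinearMap.lTensor A (sL φ) (leg13 A (Δ a) * (1 : A) ⊗ₜ[ℂ] Δ b) := by
  have hex : ∀ x : A, ∃ w, galoisMap Δ w = Δ 1 * x ⊗ₜ[ℂ] (1 : A) ∧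
      galoisProj SB e f w = w := by
    intro x
    have hx : x ∈ Submodule.span ℂ {x : A | ∃ φ : A →ₗ[ℂ] ℂ, IsLeftIntegral A Δ C φ ∧
        ∃ a b : A, x = sL (φ ∘ₗ LinearMap.mulRight ℂ b) (Δ a)} := by
      rw [D.span_slices_mulRight]; trivial
    induction hx using Submodule.span_induction with
    | mem x hx =>
      obtain ⟨φ, hφ, a, b, rfl⟩ := hx
      exact ⟨_, D.galoisMap_slice_comul hφ a b, D.galoisProj_slice φ a b⟩
    | zero => exact ⟨0, by simp, by simp⟩
    | add x y _ _ hx hy =>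
      obtain ⟨w, hw, hw'⟩ := hx
      obtain ⟨v, hv, hv'⟩ := hy
      exact ⟨w + v, by rw [map_add, hw, hv, TensorProduct.add_tmul, mul_add],
        by rw [map_add, hw', hv']⟩
    | smul c x _ hx =>
      obtain ⟨w, hw, hw'⟩ := hx
      exact ⟨c • w, by rw [map_smul, hw, ← TensorProduct.smul_tmul', mul_smul_comm],
        by rw [map_smul, hw']⟩
  choose P hP hP' using hex
  have huniq : ∀ x w, galoisMap Δ w = Δ 1 * x ⊗ₜ[ℂ] (1 : A) → galoisProj SB e f w = w →
      P x = w := fun x w hw hw' => by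
    rw [D.galois_unique ((hP x).trans hw.symm) (hP' x), hw']
  refine ⟨⟨⟨P, fun x y => ?_⟩, fun c x => ?_⟩, hP, hP', fun φ hφ a b => ?_⟩
  · refine huniq _ _ ?_ ?_
    · rw [map_add, hP, hP, TensorProduct.add_tmul, mul_add]
    · rw [map_add, hP', hP']
  · refine huniq _ _ ?_ ?_
    · rw [RingHom.id_apply, map_smul, hP, ← TensorProduct.smul_tmul', mul_smul_comm]
    · rw [RingHom.id_apply, map_smul, hP']
  · exact huniq _ _ (D.galoisMap_slice_comul hφ a b) (D.galoisProj_slice φ a b)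

theorem exists_galoisInvOp : ∃ Q : A →ₗ[ℂ] A ⊗[ℂ] A,
    ∀ φ, IsLeftIntegral A Δ C φ → ∀ a b, Q (sL (φ ∘ₗ LinearMap.mulLeft ℂ a) (Δ b)) =
      LinearMap.lTensor A (sL φ) ((1 : A) ⊗ₜ[ℂ] Δ a * leg13 A (Δ b)) := by
  have hex : ∀ x : A, ∃ w, galoisMapOp Δ w = x ⊗ₜ[ℂ] (1 : A) * Δ 1 ∧
      galoisProjOp SC e f w = w := by
    intro x
    have hx : x ∈ Submodule.span ℂ {x : A | ∃ φ : A →ₗ[ℂ] ℂ, IsLeftIntegral A Δ C φ ∧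
        ∃ a b : A, x = sL (φ ∘ₗ LinearMap.mulLeft ℂ a) (Δ b)} := by
      rw [D.span_slices_mulLeft]; trivial
    induction hx using Submodule.span_induction with
    | mem x hx =>
      obtain ⟨φ, hφ, a, b, rfl⟩ := hx
      exact ⟨_, D.galoisMapOp_slice_comul hφ a b, D.galoisProjOp_slice φ a b⟩
    | zero => exact ⟨0, by simp, by simp⟩
    | add x y _ _ hx hy =>
      obtain ⟨w, hw, hw'⟩ := hx
      obtain ⟨v, hv, hv'⟩ := hy
      exact ⟨w + v, by rw [map_add, hw, hv, TensorProduct.add_tmul, add_mul],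
        by rw [map_add, hw', hv']⟩
    | smul c x _ hx =>
      obtain ⟨w, hw, hw'⟩ := hx
      exact ⟨c • w, by rw [map_smul, hw, ← TensorProduct.smul_tmul', smul_mul_assoc],
        by rw [map_smul, hw']⟩
  choose Q hQ hQ' using hex
  have huniq : ∀ x w, galoisMapOp Δ w = x ⊗ₜ[ℂ] (1 : A) * Δ 1 → galoisProjOp SC e f w = w →
      Q x = w := fun x w hw hw' => by
    rw [D.galoisOp_unique ((hQ x).trans hw.symm) (hQ' x), hw']
  refine ⟨⟨⟨Q, fun x y => ?_⟩, fun c x => ?_⟩, fun φ hφ a b => ?_⟩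
  · refine huniq _ _ ?_ ?_
    · rw [map_add, hQ, hQ, TensorProduct.add_tmul, add_mul]
    · rw [map_add, hQ', hQ']
  · refine huniq _ _ ?_ ?_
    · rw [RingHom.id_apply, map_smul, hQ, ← TensorProduct.smul_tmul', smul_mul_assoc]
    · rw [RingHom.id_apply, map_smul, hQ']
  · exact huniq _ _ (D.galoisMapOp_slice_comul hφ a b) (D.galoisProjOp_slice φ a b)

omit D in
theorem mul'_slice (φ : A →ₗ[ℂ] ℂ) (w w' : A ⊗[ℂ] A) :
    LinearMap.mul' ℂ A (LinearMap.lTensor A (sL φ) (leg13 A w * (1 : A) ⊗ₜ[ℂ] w')) =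
      sL φ (w * w') := by
  induction w using TensorProduct.induction_on with
  | zero => simp
  | add x y hx hy => simp [add_mul, hx, hy]
  | tmul u v =>
    induction w' using TensorProduct.induction_on with
    | zero => simp
    | add x y hx hy => simp [mul_add, TensorProduct.tmul_add, hx, hy]
    | tmul p q => simp [leg13]

omit D in
theorem sR_slice (φ ε : A →ₗ[ℂ] ℂ) (w w' : A ⊗[ℂ] A) :
    sR ε (LinearMap.lTensor A (sL φ) (leg13 A w * (1 : A) ⊗ₜ[ℂ] w')) =
      sL (φ ∘ₗ LinearMap.mulLeft ℂ (sR ε w)) w' := by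
  rw [← sL_one_tmul_mul]
  induction w using TensorProduct.induction_on with
  | zero => simp
  | add x y hx hy => simp [add_mul, TensorProduct.tmul_add, hx, hy]
  | tmul u v =>
    induction w' using TensorProduct.induction_on with
    | zero => simp
    | add x y hx hy =>
      simp only [mul_add, TensorProduct.tmul_add, map_add, hx, hy]
    | tmul p q => simp [leg13, smul_smul, mul_comm]

omit D in
theorem sR_slice_op (φ ε : A →ₗ[ℂ] ℂ) (w w' : A ⊗[ℂ] A) :
    sR ε (LinearMap.lTensor A (sL φ) ((1 : A) ⊗ₜ[ℂ] w' * leg13 A w)) =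
      sL (φ ∘ₗ LinearMap.mulRight ℂ (sR ε w)) w' := by
  rw [← sL_mul_one_tmul]
  induction w using TensorProduct.induction_on with
  | zero => simp
  | add x y hx hy => simp [mul_add, TensorProduct.tmul_add, hx, hy]
  | tmul u v =>
    induction w' using TensorProduct.induction_on with
    | zero => simp
    | add x y hx hy =>
      simp only [add_mul, TensorProduct.tmul_add, map_add, hx, hy]
    | tmul p q => simp [leg13, smul_smul, mul_comm]

omit D in
theorem lTensor_slice (φ : A →ₗ[ℂ] ℂ) (w w' : A ⊗[ℂ] A) :
    LinearMap.lTensor A (sL φ ∘ₗ LinearMap.mulRight ℂ w' ∘ₗ TensorProduct.mk ℂ A A 1) w =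
      LinearMap.lTensor A (sL φ) (leg13 A w * (1 : A) ⊗ₜ[ℂ] w') := by
  induction w using TensorProduct.induction_on with
  | zero => simp
  | add x y hx hy => simp only [map_add, add_mul, hx, hy]
  | tmul u v => simp [leg13]

theorem exists_counit_antipode : ∃ (ε : A →ₗ[ℂ] ℂ) (S : A →ₗ[ℂ] A),
    (∀ x, sL ε (Δ x) = x) ∧ (∀ x, sR ε (Δ x) = x) ∧ Function.Bijective S ∧
    (∀ φ, IsLeftIntegral A Δ C φ → ∀ a b, S (sL (φ ∘ₗ LinearMap.mulRight ℂ b) (Δ a)) =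
      sL (φ ∘ₗ LinearMap.mulLeft ℂ a) (Δ b)) ∧
    (∀ x, galoisMap Δ (LinearMap.lTensor A S (Δ x)) = Δ 1 * x ⊗ₜ[ℂ] (1 : A)) ∧
    ∀ x, galoisProj SB e f (LinearMap.lTensor A S (Δ x)) = LinearMap.lTensor A S (Δ x) := by
  obtain ⟨P, hP, hP', hPs⟩ := D.exists_galoisInv
  obtain ⟨Q, hQs⟩ := D.exists_galoisInvOp
  obtain ⟨θ, hθ⟩ := D.exists_dual
  set ε : A →ₗ[ℂ] ℂ := θ ∘ₗ LinearMap.mul' ℂ A ∘ₗ P with hε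
  have hεs : ∀ φ, IsLeftIntegral A Δ C φ → ∀ a b,
      ε (sL (φ ∘ₗ LinearMap.mulRight ℂ b) (Δ a)) = φ (a * b) := by
    intro φ hφ a b
    rw [hε, LinearMap.comp_apply, LinearMap.comp_apply, hPs φ hφ, mul'_slice, ← D.mul,
      D.leftIntegral_eq_left hφ, map_sum]
    have : a * b = ∑ i, θ (f i) • ((SC.symm (e i) : A) * (a * b)) := by
      simp_rw [← smul_mul_assoc]
      rw [← Finset.sum_mul, hθ, one_mul]
    conv_rhs => rw [this, map_sum]
    exact Finset.sum_congr rfl fun i _ => by simp [mul_comm]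
  have hεL : ∀ x, sL ε (Δ x) = x := by
    intro x
    have : sL ε ∘ₗ Δ = LinearMap.id := by
      refine LinearMap.ext_on D.span_slices_mulRight ?_
      rintro _ ⟨φ, hφ, a, b, rfl⟩
      have h : ∀ (η : A →ₗ[ℂ] ℂ) (g : A →ₗ[ℂ] A) (w : A ⊗[ℂ] A),
          sL η (LinearMap.lTensor A g w) = sL (η ∘ₗ g) w := by
        intro η g w
        rw [sL, sL, LinearMap.comp_apply, LinearMap.comp_apply, LinearMap.lTensor_comp_apply]
      have h' : ε ∘ₗ sL (φ ∘ₗ LinearMap.mulRight ℂ b) ∘ₗ Δ = φ ∘ₗ LinearMap.mulRight ℂ b := by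
        ext v
        exact hεs φ hφ v b
      rw [LinearMap.comp_apply, comul_sL Δ _ D.coassoc, h, h', LinearMap.id_apply]
    exact LinearMap.congr_fun this x
  have hεR : ∀ x, sR ε (Δ x) = x := by
    intro x
    rw [← sub_eq_zero]
    refine D.faithfulL.1 _ fun φ hφ b => ?_
    rw [sub_mul, map_sub, sub_eq_zero, ← hεs φ hφ x b, apply_sL_eq_apply_sR]
    rfl
  set S : A →ₗ[ℂ] A := sR ε ∘ₗ P with hS
  have hSs : ∀ φ, IsLeftIntegral A Δ C φ → ∀ a b,
      S (sL (φ ∘ₗ LinearMap.mulRight ℂ b) (Δ a)) = sL (φ ∘ₗ LinearMap.mulLeft ℂ a) (Δ b) := by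
    intro φ hφ a b
    rw [hS, LinearMap.comp_apply, hPs φ hφ, sR_slice, hεR]
  have hSs' : ∀ φ, IsLeftIntegral A Δ C φ → ∀ a b,
      (sR ε ∘ₗ Q) (sL (φ ∘ₗ LinearMap.mulLeft ℂ a) (Δ b)) =
        sL (φ ∘ₗ LinearMap.mulRight ℂ b) (Δ a) := by
    intro φ hφ a b
    rw [LinearMap.comp_apply, hQs φ hφ, sR_slice_op, hεR]
  have hleft : (sR ε ∘ₗ Q) ∘ₗ S = LinearMap.id := by
    refine LinearMap.ext_on D.span_slices_mulRight ?_
    rintro _ ⟨φ, hφ, a, b, rfl⟩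
    rw [LinearMap.comp_apply, hSs φ hφ, hSs' φ hφ, LinearMap.id_apply]
  have hright : S ∘ₗ (sR ε ∘ₗ Q) = LinearMap.id := by
    refine LinearMap.ext_on D.span_slices_mulLeft ?_
    rintro _ ⟨φ, hφ, a, b, rfl⟩
    rw [LinearMap.comp_apply, hSs' φ hφ, hSs φ hφ, LinearMap.id_apply]
  have hPS : ∀ x, LinearMap.lTensor A S (Δ x) = P x := by
    intro x
    have : LinearMap.lTensor A S ∘ₗ Δ = P := by
      refine LinearMap.ext_on D.span_slices_mulRight ?_
      rintro _ ⟨φ, hφ, a, b, rfl⟩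
      have h : S ∘ₗ sL (φ ∘ₗ LinearMap.mulRight ℂ b) ∘ₗ Δ =
          sL φ ∘ₗ LinearMap.mulRight ℂ (Δ b) ∘ₗ TensorProduct.mk ℂ A A 1 := by
        ext v
        exact (hSs φ hφ v b).trans (sL_one_tmul_mul _ _ _).symm
      rw [LinearMap.comp_apply, comul_sL Δ _ D.coassoc, ← LinearMap.lTensor_comp_apply, h,
        lTensor_slice, hPs φ hφ]
    exact LinearMap.congr_fun this x
  refine ⟨ε, S, hεL, hεR, Function.bijective_iff_has_inverse.2
    ⟨sR ε ∘ₗ Q, LinearMap.congr_fun hleft, LinearMap.congr_fun hright⟩, hSs, ?_, ?_⟩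
  · intro x
    rw [hPS, hP]
  · intro x
    rw [hPS, hP']

end SeparableComul

/-- A counit `ε` together with a map `S` satisfying `a₁ ⊗ S(a₂) = R(a ⊗ 1)`, where `R` is the
generalized inverse of the canonical map. -/
structure IsCanonicalAntipode {A : Type} [Ring A] [Algebra ℂ A] (Δ : A →ₗ[ℂ] A ⊗[ℂ] A)
    {B C : Subalgebra ℂ A} (SB : B ≃ₗ[ℂ] C) {n : ℕ} (e : Fin n → B) (f : Fin n → C)
    (ε : A →ₗ[ℂ] ℂ) (S : A →ₗ[ℂ] A) : Prop where
  counitL : ∀ x, sL ε (Δ x) = x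
  counitR : ∀ x, sR ε (Δ x) = x
  slice : ∀ φ, IsLeftIntegral A Δ C φ → ∀ a b,
    S (sL (φ ∘ₗ LinearMap.mulRight ℂ b) (Δ a)) = sL (φ ∘ₗ LinearMap.mulLeft ℂ a) (Δ b)
  galois : ∀ x, galoisMap Δ (LinearMap.lTensor A S (Δ x)) = Δ 1 * x ⊗ₜ[ℂ] (1 : A)
  proj : ∀ x, galoisProj SB e f (LinearMap.lTensor A S (Δ x)) = LinearMap.lTensor A S (Δ x)

namespace IsCanonicalAntipode

variable {A : Type} [Ring A] [Algebra ℂ A] {Δ : A →ₗ[ℂ] A ⊗[ℂ] A}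
  {B C : Subalgebra ℂ A} {SB : B ≃ₗ[ℂ] C} {SC : C ≃ₗ[ℂ] B} {n : ℕ}
  {e : Fin n → B} {f : Fin n → C} {ε : A →ₗ[ℂ] ℂ} {S : A →ₗ[ℂ] A}
  (H : IsCanonicalAntipode Δ SB e f ε S) (D : SeparableComul Δ SB SC e f)

include H

theorem sR_counit_galoisMap (w : A ⊗[ℂ] A) :
    sR ε (galoisMap Δ w) = LinearMap.mul' ℂ A w := by
  induction w using TensorProduct.induction_on with
  | zero => simp
  | tmul a b => simp [sR_mul_one_tmul, H.counitR]
  | add x y hx hy => simp [hx, hy]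

theorem mul_id_antipode (a : A) :
    LinearMap.mul' ℂ A (LinearMap.lTensor A S (Δ a)) = sR ε (Δ 1 * a ⊗ₜ[ℂ] (1 : A)) := by
  rw [← H.sR_counit_galoisMap, H.galois]

include D

theorem lTensor_mul_antipode_id (x : A) :
    LinearMap.lTensor A (LinearMap.mul' ℂ A ∘ₗ LinearMap.rTensor A S ∘ₗ Δ) (Δ x) =
      galoisProj SB e f (x ⊗ₜ[ℂ] (1 : A)) := by
  set X : A ⊗[ℂ] A →ₗ[ℂ] A ⊗[ℂ] A := LinearMap.lTensor A (LinearMap.mul' ℂ A) ∘ₗ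
    (TensorProduct.assoc ℂ A A A).toLinearMap ∘ₗ
      LinearMap.rTensor A (LinearMap.lTensor A S ∘ₗ Δ) with hX
  have hXt : ∀ u v, X (u ⊗ₜ[ℂ] v) = LinearMap.lTensor A S (Δ u) * (1 : A) ⊗ₜ[ℂ] v := by
    intro u v
    simp only [hX, LinearMap.comp_apply, LinearMap.rTensor_tmul, LinearEquiv.coe_coe]
    induction LinearMap.lTensor A S (Δ u) using TensorProduct.induction_on with
    | zero => simp
    | tmul p q => simp
    | add x y hx hy => simp [add_mul, TensorProduct.add_tmul, hx, hy]
  have hXeq : LinearMap.lTensor A (LinearMap.mul' ℂ A ∘ₗ LinearMap.rTensor A S ∘ₗ Δ) (Δ x) =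
      X (Δ x) := by
    have h : ∀ w : (A ⊗[ℂ] A) ⊗[ℂ] A,
        TensorProduct.assoc ℂ A A A (LinearMap.rTensor A (LinearMap.lTensor A S) w) =
        LinearMap.lTensor A (LinearMap.rTensor A S) (TensorProduct.assoc ℂ A A A w) := by
      intro w
      induction w using TensorProduct.induction_on with
      | zero => simp
      | add x y hx hy => simp [hx, hy]
      | tmul u v =>
        induction u using TensorProduct.induction_on with
        | zero => simp
        | add x y hx hy => simp only [TensorProduct.add_tmul, map_add, hx, hy]
        | tmul p q => simp
    simp only [hX, LinearMap.comp_apply, LinearEquiv.coe_coe, LinearMap.rTensor_comp,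
      LinearMap.lTensor_comp]
    rw [h, D.coassoc]
  have hgal : ∀ w, galoisMap Δ (X w) = Δ 1 * w := by
    intro w
    induction w using TensorProduct.induction_on with
    | zero => simp
    | tmul u v => simp [hXt, galoisMap_mul_one_tmul, H.galois, mul_assoc]
    | add x y hx hy => simp [mul_add, hx, hy]
  have hproj : ∀ w, galoisProj SB e f (X w) = X w := by
    have h : ∀ (w : A ⊗[ℂ] A) (v : A), galoisProj SB e f (w * (1 : A) ⊗ₜ[ℂ] v) =
        galoisProj SB e f w * (1 : A) ⊗ₜ[ℂ] v := by
      intro w v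
      induction w using TensorProduct.induction_on with
      | zero => simp
      | tmul p q => simp [galoisProj, Finset.sum_mul, mul_assoc]
      | add x y hx hy => simp [add_mul, hx, hy]
    intro w
    induction w using TensorProduct.induction_on with
    | zero => simp
    | tmul u v => rw [hXt, h, H.proj]
    | add x y hx hy => simp [hx, hy]
  rw [hXeq]
  refine D.galois_unique ?_ (hproj _)
  rw [hgal, D.one_comul_mul, galoisMap_tmul, ← Algebra.TensorProduct.one_def, mul_one]

theorem counit_mul (x : A) (c : C) : ε (x * SB.symm c) = ε (x * c) := by
  have h1 : sL ε (Δ x * (SB.symm c : A) ⊗ₜ[ℂ] (1 : A)) = x * SB.symm c := by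
    rw [sL_mul_tmul_one, H.counitL]
  rw [← h1, apply_sL_eq_apply_sR, ← D.comul_mul_right, sR_mul_one_tmul, H.counitR]

theorem mul_antipode_id_eq_sum (x : A) :
    LinearMap.mul' ℂ A (LinearMap.rTensor A S (Δ x)) =
      ∑ i, ε (x * SB.symm (f i)) • (e i : A) := by
  have h := congrArg (sR ε) (H.lTensor_mul_antipode_id D x)
  rw [sR_lTensor, H.counitR] at h
  simpa [galoisProj] using h

theorem mul_antipode_id (x : A) :
    LinearMap.mul' ℂ A (LinearMap.rTensor A S (Δ x)) = sL ε ((1 : A) ⊗ₜ[ℂ] x * Δ 1) := by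
  rw [H.mul_antipode_id_eq_sum D, D.one, Finset.mul_sum, map_sum]
  refine Finset.sum_congr rfl fun i _ => ?_
  rw [H.counit_mul D]
  simp

theorem rTensor_mul_antipode_id (x : A) :
    LinearMap.rTensor A (LinearMap.mul' ℂ A ∘ₗ LinearMap.rTensor A S ∘ₗ Δ) (Δ x) =
      (1 : A) ⊗ₜ[ℂ] x * Δ 1 := by
  have h : LinearMap.mul' ℂ A ∘ₗ LinearMap.rTensor A S ∘ₗ Δ =
      ∑ i, (ε ∘ₗ LinearMap.mulRight ℂ (SB.symm (f i) : A)).smulRight (e i : A) := by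
    ext x
    simp [H.mul_antipode_id_eq_sum D]
  rw [h, rTensor_sum_smulRight, D.one, Finset.mul_sum]
  refine Finset.sum_congr rfl fun i _ => ?_
  rw [← sR_mul_tmul_one, ← D.comul_mul_right, sR_mul_one_tmul, H.counitR]
  simp

theorem antipode_mul_left (b : B) (x : A) : S (b * x) = S x * SB b := by
  have hproj : galoisProj SB e f (LinearMap.lTensor A S (Δ x) * (1 : A) ⊗ₜ[ℂ] (SB b : A)) =
      LinearMap.lTensor A S (Δ x) * (1 : A) ⊗ₜ[ℂ] (SB b : A) := by
    conv_rhs => rw [← H.proj]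
    induction LinearMap.lTensor A S (Δ x) using TensorProduct.induction_on with
    | zero => simp
    | tmul p q => simp [galoisProj, Finset.sum_mul, mul_assoc]
    | add x y hx hy => simp only [add_mul, map_add, hx, hy]
  have h : LinearMap.lTensor A S (Δ x) * (1 : A) ⊗ₜ[ℂ] (SB b : A) =
      LinearMap.lTensor A S (Δ (b * x)) := by
    rw [D.galois_unique (w' := LinearMap.lTensor A S (Δ (b * x))) ?_ hproj, H.proj]
    rw [galoisMap_mul_one_tmul, H.galois, H.galois, ← one_mul (1 : A),
      ← Algebra.TensorProduct.tmul_mul_tmul, ← mul_assoc, one_mul, D.one_mul_left, mul_assoc,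
      mul_assoc]
    simp
  have h' := congrArg (sR ε) h
  rw [sR_mul_one_tmul, sR_lTensor, sR_lTensor, H.counitR, H.counitR] at h'
  exact h'.symm

theorem sum_SB_mul : ∑ i, (SB (e i) : A) * f i = 1 := by
  have h : Δ 1 * (1 : A) ⊗ₜ[ℂ] (∑ i, (SB (e i) : A) * f i) = Δ 1 := by
    refine Eq.trans ?_ (D.mul_one_comul 1)
    conv_rhs => arg 2; rw [D.one]
    rw [TensorProduct.tmul_sum, Finset.mul_sum, Finset.mul_sum]
    refine Finset.sum_congr rfl fun i _ => ?_
    rw [← one_mul (1 : A), ← Algebra.TensorProduct.tmul_mul_tmul, ← mul_assoc, one_mul,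
      ← D.one_mul_left, mul_assoc]
    simp
  have h' := congrArg (sR ε) h
  rwa [sR_mul_one_tmul, H.counitR, one_mul] at h'

theorem antipode_one : S 1 = 1 := by
  have h := H.mul_antipode_id D 1
  rw [← Algebra.TensorProduct.one_def, one_mul, H.counitL, D.one] at h
  refine Eq.trans ?_ h
  conv_lhs => rw [← mul_one (S 1)]; arg 2; rw [← H.sum_SB_mul D]
  rw [Finset.mul_sum]
  simp only [map_sum, LinearMap.rTensor_tmul, LinearMap.mul'_apply]
  refine Finset.sum_congr rfl fun i _ => ?_
  rw [← mul_assoc, ← H.antipode_mul_left D, mul_one]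

omit H D in
theorem lTensor_sL_mulLeft (φ : A →ₗ[ℂ] ℂ) (w w' : A ⊗[ℂ] A) :
    LinearMap.lTensor A (sL φ ∘ₗ LinearMap.mulLeft ℂ w ∘ₗ TensorProduct.mk ℂ A A 1) w' =
      TensorProduct.comm ℂ A A
        (LinearMap.lTensor A (sL φ) (leg13 A w * (1 : A) ⊗ₜ[ℂ] w')) := by
  induction w' using TensorProduct.induction_on with
  | zero => simp
  | add x y hx hy => simp only [TensorProduct.tmul_add, mul_add, map_add, hx, hy]
  | tmul p q =>
    induction w using TensorProduct.induction_on with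
    | zero => simp
    | add x y hx hy =>
      simp only [LinearMap.lTensor_tmul, LinearMap.comp_apply, LinearMap.mulLeft_apply,
        add_mul, map_add, TensorProduct.tmul_add] at hx hy ⊢
      rw [hx, hy]
    | tmul u v => simp [leg13, TensorProduct.smul_tmul']

theorem comul_antipode (x : A) :
    Δ (S x) = TensorProduct.comm ℂ A A (TensorProduct.map S S (Δ x)) := by
  have key : Δ ∘ₗ S =
      (TensorProduct.comm ℂ A A).toLinearMap ∘ₗ TensorProduct.map S S ∘ₗ Δ := by
    refine LinearMap.ext_on D.span_slices_mulRight ?_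
    rintro _ ⟨φ, hφ, a, b, rfl⟩
    have hb : S ∘ₗ sL (φ ∘ₗ LinearMap.mulRight ℂ b) ∘ₗ Δ =
        sL φ ∘ₗ LinearMap.mulRight ℂ (Δ b) ∘ₗ TensorProduct.mk ℂ A A 1 := by
      ext v
      exact (H.slice φ hφ v b).trans (sL_one_tmul_mul _ _ _).symm
    have ha : sL (φ ∘ₗ LinearMap.mulLeft ℂ a) ∘ₗ Δ =
        S ∘ₗ sL φ ∘ₗ LinearMap.mulLeft ℂ (Δ a) ∘ₗ TensorProduct.mk ℂ A A 1 := by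
      ext v
      exact (H.slice φ hφ a v).symm.trans (congrArg S (sL_mul_one_tmul _ _ _).symm)
    have hcomm : ∀ w : A ⊗[ℂ] A, TensorProduct.comm ℂ A A (LinearMap.rTensor A S w) =
        LinearMap.lTensor A S (TensorProduct.comm ℂ A A w) := by
      intro w
      induction w using TensorProduct.induction_on with
      | zero => simp
      | tmul u v => simp
      | add x y hx hy => simp only [map_add, hx, hy]
    simp only [LinearMap.comp_apply, LinearEquiv.coe_coe]
    rw [H.slice φ hφ, comul_sL Δ _ D.coassoc, comul_sL Δ _ D.coassoc, ha,
      LinearMap.lTensor_comp_apply, lTensor_sL_mulLeft, ← LinearMap.rTensor_comp_lTensor,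
      LinearMap.comp_apply, hcomm, ← LinearMap.lTensor_comp_apply, hb,
      SeparableComul.lTensor_slice]
  exact LinearMap.congr_fun key x

theorem rTensor_antipode_mul (c d : A) :
    LinearMap.rTensor A ((MulOpposite.opLinearEquiv ℂ).toLinearMap ∘ₗ S) (Δ c) *
      LinearMap.rTensor A ((MulOpposite.opLinearEquiv ℂ).toLinearMap ∘ₗ S) (Δ d) =
    LinearMap.rTensor A ((MulOpposite.opLinearEquiv ℂ).toLinearMap ∘ₗ S) (Δ c * Δ d) := by
  set T := LinearMap.rTensor A
    ((MulOpposite.opLinearEquiv ℂ).toLinearMap ∘ₗ S : A →ₗ[ℂ] Aᵐᵒᵖ) with hT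
  have hsT : ∀ (ω : A →ₗ[ℂ] ℂ) w, sL ω (T w) = MulOpposite.op (S (sL ω w)) := by
    intro ω w
    rw [hT, sL_rTensor]
    rfl
  set Y : A ⊗[ℂ] A →ₗ[ℂ] A ⊗[ℂ] A :=
    LinearMap.rTensor A (LinearMap.mul' ℂ A ∘ₗ LinearMap.rTensor A S) ∘ₗ
      (TensorProduct.assoc ℂ A A A).symm.toLinearMap ∘ₗ LinearMap.lTensor A Δ with hY
  have hYt : ∀ p q, Y (p ⊗ₜ[ℂ] q) = S p ⊗ₜ[ℂ] (1 : A) * Δ q := by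
    intro p q
    simp only [hY, LinearMap.comp_apply, LinearMap.lTensor_tmul, LinearEquiv.coe_coe]
    induction Δ q using TensorProduct.induction_on with
    | zero => simp
    | tmul u v => simp
    | add x y hx hy => simp only [mul_add, TensorProduct.tmul_add, map_add, hx, hy]
  have hYΔ : Y (Δ d) = (1 : A) ⊗ₜ[ℂ] d * Δ 1 := by
    rw [← H.rTensor_mul_antipode_id D]
    simp only [hY, LinearMap.comp_apply, LinearEquiv.coe_coe, LinearMap.rTensor_comp]
    rw [← D.coassoc, LinearEquiv.symm_apply_apply]
  rw [← sub_eq_zero]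
  refine eq_zero_of_separating_sL (Ω := {ω | ∃ φ : A →ₗ[ℂ] ℂ, IsLeftIntegral A Δ C φ ∧
    ∃ b, ω = φ ∘ₗ LinearMap.mulRight ℂ b}) (fun v hv => D.faithfulL.1 v fun φ hφ b =>
      hv _ ⟨φ, hφ, b, rfl⟩) _ ?_
  rintro _ ⟨φ, hφ, b, rfl⟩
  have key : ∀ w : A ⊗[ℂ] A, sL (φ ∘ₗ LinearMap.mulRight ℂ b) (T (Δ c) * T w) =
      MulOpposite.op (sL φ ((1 : A) ⊗ₜ[ℂ] c * Y w * Δ b)) := by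
    intro w
    induction w using TensorProduct.induction_on with
    | zero => simp
    | add x y hx hy =>
      simp only [map_add, mul_add, add_mul, hx, hy, MulOpposite.op_add]
    | tmul p q =>
      have h1 : T (p ⊗ₜ[ℂ] q) =
          (1 : Aᵐᵒᵖ) ⊗ₜ[ℂ] q * MulOpposite.op (S p) ⊗ₜ[ℂ] (1 : A) := by
        simp [hT]
      rw [h1, ← mul_assoc, sL_mul_tmul_one, sL_mul_one_tmul, hsT, LinearMap.comp_assoc,
        ← LinearMap.mulRight_mul, H.slice φ hφ, hYt, ← MulOpposite.op_mul, ← mul_assoc,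
        D.mul, ← sL_one_tmul_mul, ← sL_tmul_one_mul]
      congr 2
      simp only [← mul_assoc]
      congr 2
      simp
  rw [map_sub, key, hYΔ, hsT, ← D.mul, H.slice φ hφ, ← sL_one_tmul_mul, mul_assoc, mul_assoc,
    D.one_comul_mul, ← mul_assoc, Algebra.TensorProduct.tmul_mul_tmul, mul_one, sub_self]

theorem antipode_mul (c d : A) : S (c * d) = S d * S c := by
  set T := LinearMap.rTensor A
    ((MulOpposite.opLinearEquiv ℂ).toLinearMap ∘ₗ S : A →ₗ[ℂ] Aᵐᵒᵖ) with hT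
  have hsT : ∀ (ω : A →ₗ[ℂ] ℂ) w, sL ω (T w) = MulOpposite.op (S (sL ω w)) := by
    intro ω w
    rw [hT, sL_rTensor]
    rfl
  have hTmul : ∀ w z, T (w * (1 : A) ⊗ₜ[ℂ] z) = T w * (1 : Aᵐᵒᵖ) ⊗ₜ[ℂ] z := by
    intro w z
    induction w using TensorProduct.induction_on with
    | zero => simp
    | tmul u v => simp [hT]
    | add x y hx hy => simp only [add_mul, map_add, hx, hy]
  have hgal : ∀ c v, T (Δ c) * T (galoisMap Δ v) = T (Δ c * galoisMap Δ v) := by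
    intro c v
    induction v using TensorProduct.induction_on with
    | zero => simp
    | tmul u v =>
      rw [galoisMap_tmul, hTmul, ← mul_assoc, ← mul_assoc, hTmul, H.rTensor_antipode_mul D]
    | add x y hx hy => simp only [mul_add, map_add, hx, hy]
  have hsum : ∀ c d, S (c * d) = S d * ∑ i, (SB (e i) : A) * S (c * SB.symm (f i)) := by
    intro c d
    have h := hgal c (LinearMap.lTensor A S (Δ d))
    rw [H.galois, ← mul_assoc, D.mul_one_comul] at h
    apply MulOpposite.op_injective
    have h' := congrArg (sL ε) h
    rw [hsT, sL_mul_tmul_one, H.counitL] at h'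
    rw [← h', D.one, Finset.sum_mul, map_sum, Finset.mul_sum, map_sum, Finset.mul_sum,
      Finset.op_sum]
    refine Finset.sum_congr rfl fun i _ => ?_
    have h1 : T ((e i : A) ⊗ₜ[ℂ] (f i : A) * d ⊗ₜ[ℂ] (1 : A)) =
        (1 : Aᵐᵒᵖ) ⊗ₜ[ℂ] (f i : A) * MulOpposite.op (S d * SB (e i)) ⊗ₜ[ℂ] (1 : A) := by
      simp [hT, H.antipode_mul_left D]
    rw [h1, ← mul_assoc, ← hTmul, D.comul_mul_right, sL_mul_tmul_one, hsT, sL_mul_tmul_one,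
      H.counitL, ← MulOpposite.op_mul, mul_assoc]
  rw [hsum, ← one_mul (∑ i, _), ← H.antipode_one D, ← hsum, mul_one]

end IsCanonicalAntipode

section FullIdempotent

theorem exists_sL_eq {V W : Type} [AddCommGroup V] [Module ℂ V] [AddCommGroup W] [Module ℂ W]
    {w : V ⊗[ℂ] W} (h : Submodule.span ℂ {x : V | ∃ ω : W →ₗ[ℂ] ℂ, x = sL ω w} = ⊤) (v : V) :
    ∃ ω : W →ₗ[ℂ] ℂ, sL ω w = v := by
  have hv : v ∈ Submodule.span ℂ {x : V | ∃ ω : W →ₗ[ℂ] ℂ, x = sL ω w} := h ▸ Submodule.mem_top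
  induction hv using Submodule.span_induction with
  | mem x hx => exact hx.imp fun _ => Eq.symm
  | zero => exact ⟨0, by simp [sL]⟩
  | add x y _ _ hx hy =>
    obtain ⟨ω, rfl⟩ := hx
    obtain ⟨η, rfl⟩ := hy
    exact ⟨ω + η, by simp [sL, LinearMap.lTensor_add]⟩
  | smul r x _ hx =>
    obtain ⟨ω, rfl⟩ := hx
    exact ⟨r • ω, by simp [sL, LinearMap.lTensor_smul]⟩

theorem exists_sR_eq {V W : Type} [AddCommGroup V] [Module ℂ V] [AddCommGroup W] [Module ℂ W]
    {w : V ⊗[ℂ] W} (h : Submodule.span ℂ {x : W | ∃ ω : V →ₗ[ℂ] ℂ, x = sR ω w} = ⊤) (v : W) :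
    ∃ ω : V →ₗ[ℂ] ℂ, sR ω w = v := by
  have hv : v ∈ Submodule.span ℂ {x : W | ∃ ω : V →ₗ[ℂ] ℂ, x = sR ω w} := h ▸ Submodule.mem_top
  induction hv using Submodule.span_induction with
  | mem x hx => exact hx.imp fun _ => Eq.symm
  | zero => exact ⟨0, by simp [sR]⟩
  | add x y _ _ hx hy =>
    obtain ⟨ω, rfl⟩ := hx
    obtain ⟨η, rfl⟩ := hy
    exact ⟨ω + η, by simp [sR, LinearMap.rTensor_add]⟩
  | smul r x _ hx =>
    obtain ⟨ω, rfl⟩ := hx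
    exact ⟨r • ω, by simp [sR, LinearMap.rTensor_smul]⟩

variable {A : Type} [Ring A] [Algebra ℂ A]

theorem lTensor_sL_leg12_mul (θ : A →ₗ[ℂ] ℂ) (w w' : A ⊗[ℂ] A) :
    LinearMap.lTensor A (sL θ) (leg12 A w * (1 : A) ⊗ₜ[ℂ] w') =
      w * (1 : A) ⊗ₜ[ℂ] sL θ w' := by
  induction w using TensorProduct.induction_on with
  | zero => simp
  | add x y hx hy => simp only [add_mul, map_add, hx, hy]
  | tmul u v =>
    induction w' using TensorProduct.induction_on with
    | zero => simp
    | add x y hx hy => simp only [mul_add, TensorProduct.tmul_add, map_add, hx, hy]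
    | tmul p q => simp [leg12]

theorem lTensor_sL_mul_leg12 (θ : A →ₗ[ℂ] ℂ) (w w' : A ⊗[ℂ] A) :
    LinearMap.lTensor A (sL θ) ((1 : A) ⊗ₜ[ℂ] w' * leg12 A w) =
      (1 : A) ⊗ₜ[ℂ] sL θ w' * w := by
  induction w using TensorProduct.induction_on with
  | zero => simp
  | add x y hx hy => simp only [mul_add, map_add, hx, hy]
  | tmul u v =>
    induction w' using TensorProduct.induction_on with
    | zero => simp
    | add x y hx hy => simp only [add_mul, TensorProduct.tmul_add, map_add, hx, hy]
    | tmul p q => simp [leg12]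

theorem rTensor_sR_leg12_mul (θ : A →ₗ[ℂ] ℂ) (w w' : A ⊗[ℂ] A) :
    LinearMap.rTensor A (sR θ)
      ((TensorProduct.assoc ℂ A A A).symm (leg12 A w * (1 : A) ⊗ₜ[ℂ] w')) =
      sR θ w ⊗ₜ[ℂ] (1 : A) * w' := by
  induction w using TensorProduct.induction_on with
  | zero => simp
  | add x y hx hy => simp only [add_mul, TensorProduct.add_tmul, map_add, hx, hy]
  | tmul u v =>
    induction w' using TensorProduct.induction_on with
    | zero => simp
    | add x y hx hy => simp only [mul_add, TensorProduct.tmul_add, map_add, hx, hy]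
    | tmul p q => simp [leg12]

theorem rTensor_sR_mul_leg12 (θ : A →ₗ[ℂ] ℂ) (w w' : A ⊗[ℂ] A) :
    LinearMap.rTensor A (sR θ)
      ((TensorProduct.assoc ℂ A A A).symm ((1 : A) ⊗ₜ[ℂ] w' * leg12 A w)) =
      w' * sR θ w ⊗ₜ[ℂ] (1 : A) := by
  induction w using TensorProduct.induction_on with
  | zero => simp
  | add x y hx hy => simp only [mul_add, TensorProduct.add_tmul, map_add, hx, hy]
  | tmul u v =>
    induction w' using TensorProduct.induction_on with
    | zero => simp
    | add x y hx hy => simp only [add_mul, TensorProduct.tmul_add, map_add, hx, hy]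
    | tmul p q => simp [leg12]

end FullIdempotent

theorem LinearEquiv.map_one_of_anti {B C : Type} [Ring B] [Ring C] [Module ℂ B] [Module ℂ C]
    (T : C ≃ₗ[ℂ] B) (hT : ∀ c c', T (c * c') = T c' * T c) : T 1 = 1 := by
  have h := hT (T.symm 1) 1
  rwa [mul_one, T.apply_symm_apply, mul_one, eq_comm] at h

theorem statement17
    (A : Type) [Ring A] [Algebra ℂ A]
    (Δ : A →ₗ[ℂ] A ⊗[ℂ] A)
    (hΔmul : ∀ a a' : A, Δ (a * a') = Δ a * Δ a')
    (hΔcoassoc : ∀ a : A,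
      TensorProduct.assoc ℂ A A A (LinearMap.rTensor A Δ (Δ a)) = LinearMap.lTensor A Δ (Δ a))
    (hΔfullL : Submodule.span ℂ {x : A | ∃ ω : A →ₗ[ℂ] ℂ, ∃ a : A, x = sL ω (Δ a)} = ⊤)
    (hΔfullR : Submodule.span ℂ {x : A | ∃ ω : A →ₗ[ℂ] ℂ, ∃ a : A, x = sR ω (Δ a)} = ⊤)
    (E : A ⊗[ℂ] A)
    (hEE : E * E = E)
    (hEΔ : ∀ a : A, E * Δ a = Δ a ∧ Δ a * E = Δ a)
    (hranL : (Submodule.span ℂ {y : A ⊗[ℂ] A | ∃ a z, y = Δ a * z} : Set (A ⊗[ℂ] A)) =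
      {y : A ⊗[ℂ] A | ∃ z, y = E * z})
    (hranR : (Submodule.span ℂ {y : A ⊗[ℂ] A | ∃ a z, y = z * Δ a} : Set (A ⊗[ℂ] A)) =
      {y : A ⊗[ℂ] A | ∃ z, y = z * E})
    (hΔE1 : TensorProduct.assoc ℂ A A A (LinearMap.rTensor A Δ E) =
      leg12 A E * ((1 : A) ⊗ₜ[ℂ] E))
    (hΔE2 : leg12 A E * ((1 : A) ⊗ₜ[ℂ] E) = ((1 : A) ⊗ₜ[ℂ] E) * leg12 A E)
    (B C : Subalgebra ℂ A)
    (E' : ↥B ⊗[ℂ] ↥C)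
    (hE'E : TensorProduct.map B.val.toLinearMap C.val.toLinearMap E' = E)
    (hE'full1 : Submodule.span ℂ {x : ↥B | ∃ ω : ↥C →ₗ[ℂ] ℂ, x = sL ω E'} = ⊤)
    (hE'full2 : Submodule.span ℂ {y : ↥C | ∃ ω : ↥B →ₗ[ℂ] ℂ, y = sR ω E'} = ⊤)
    (SB : ↥B ≃ₗ[ℂ] ↥C) (SC : ↥C ≃ₗ[ℂ] ↥B)
    (hSBanti : ∀ b b' : ↥B, SB (b * b') = SB b' * SB b)
    (hSCanti : ∀ c c' : ↥C, SC (c * c') = SC c' * SC c)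
    (hSBrel : ∀ b : ↥B, E' * (b ⊗ₜ[ℂ] (1 : ↥C)) = E' * ((1 : ↥B) ⊗ₜ[ℂ] SB b))
    (hSCrel : ∀ c : ↥C, ((1 : ↥B) ⊗ₜ[ℂ] c) * E' = (SC c ⊗ₜ[ℂ] (1 : ↥C)) * E')
    (hfaithL : FaithfulLeftIntegrals A Δ C)
    (hfaithR : FaithfulRightIntegrals A Δ B) :
    ∃ (ε : A →ₗ[ℂ] ℂ) (S : A →ₗ[ℂ] A),
      (∀ a b : A, sR ε (Δ a * ((1 : A) ⊗ₜ[ℂ] b)) = a * b ∧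
        sL ε ((a ⊗ₜ[ℂ] (1 : A)) * Δ b) = a * b) ∧
      Function.Bijective S ∧
      (∀ a a' : A, S (a * a') = S a' * S a) ∧
      (∀ a : A, Δ (S a) = TensorProduct.comm ℂ A A (TensorProduct.map S S (Δ a))) ∧
      (∀ a : A, LinearMap.mul' ℂ A (TensorProduct.map S LinearMap.id (Δ a)) =
        sL ε (((1 : A) ⊗ₜ[ℂ] a) * E)) ∧
      (∀ a : A, LinearMap.mul' ℂ A (TensorProduct.map LinearMap.id S (Δ a)) =
        sR ε (E * (a ⊗ₜ[ℂ] (1 : A)))) := by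
  obtain ⟨n, e, f, hef⟩ := TensorProduct.exists_sum_tmul_eq E'
  have hι : Algebra.TensorProduct.map B.val C.val E' = E := hE'E
  have hone : Δ 1 = E := by
    have hmem : E ∈ (Submodule.span ℂ {y : A ⊗[ℂ] A | ∃ a z, y = Δ a * z} : Set (A ⊗[ℂ] A)) := by
      rw [hranL]
      exact ⟨1, (mul_one E).symm⟩
    have hfix : ∀ y ∈ Submodule.span ℂ {y : A ⊗[ℂ] A | ∃ a z, y = Δ a * z}, Δ 1 * y = y := by
      intro y hy
      induction hy using Submodule.span_induction with
      | mem x hx =>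
        obtain ⟨a, z, rfl⟩ := hx
        rw [← mul_assoc, ← hΔmul, one_mul]
      | zero => simp
      | add x y _ _ hx hy => rw [mul_add, hx, hy]
      | smul r x _ hx => rw [mul_smul_comm, hx]
    rw [← (hEΔ 1).2, hfix E hmem]
  have hsum : E = ∑ i, (e i : A) ⊗ₜ[ℂ] (f i : A) := by
    rw [← hι, hef]
    simp
  have hsliceB : ∀ b : B, ∃ θ : A →ₗ[ℂ] ℂ, ∑ i, θ (f i) • e i = b := by
    intro b
    obtain ⟨ω, hω⟩ := exists_sL_eq hE'full1 b
    obtain ⟨θ, hθ⟩ := ω.exists_extend (p := Subalgebra.toSubmodule C)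
    refine ⟨θ, ?_⟩
    rw [← hω, hef, map_sum]
    refine Finset.sum_congr rfl fun i _ => ?_
    rw [sL_tmul, ← hθ]
    rfl
  have hsliceC : ∀ c : C, ∃ θ : A →ₗ[ℂ] ℂ, ∑ i, θ (e i) • f i = c := by
    intro c
    obtain ⟨ω, hω⟩ := exists_sR_eq hE'full2 c
    obtain ⟨θ, hθ⟩ := ω.exists_extend (p := Subalgebra.toSubmodule B)
    refine ⟨θ, ?_⟩
    rw [← hω, hef, map_sum]
    refine Finset.sum_congr rfl fun i _ => ?_
    rw [sR_tmul, ← hθ]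
    rfl
  have hsL : ∀ b ∈ B, ∃ θ : A →ₗ[ℂ] ℂ, sL θ E = b := by
    intro b hb
    obtain ⟨θ, hθ⟩ := hsliceB ⟨b, hb⟩
    refine ⟨θ, ?_⟩
    have h := congrArg (Subtype.val : B → A) hθ
    rw [hsum, map_sum]
    simpa using h
  have hsR : ∀ c ∈ C, ∃ θ : A →ₗ[ℂ] ℂ, sR θ E = c := by
    intro c hc
    obtain ⟨θ, hθ⟩ := hsliceC ⟨c, hc⟩
    refine ⟨θ, ?_⟩
    have h := congrArg (Subtype.val : C → A) hθ
    rw [hsum, map_sum]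
    simpa using h
  have hΔE : LinearMap.lTensor A Δ E = leg12 A E * (1 : A) ⊗ₜ[ℂ] E := by
    rw [← hΔE1, ← hone, hΔcoassoc]
  have D : SeparableComul Δ SB SC e f :=
    { mul := hΔmul
      coassoc := hΔcoassoc
      fullL := hΔfullL
      fullR := hΔfullR
      one := hone.trans hsum
      one_mul_left := fun b => by
        have h := congrArg (Algebra.TensorProduct.map B.val C.val) (hSBrel b)
        rw [map_mul, map_mul, hι] at h
        rw [hone]
        simpa using h
      right_mul_one := fun c => by
        have h := congrArg (Algebra.TensorProduct.map B.val C.val) (hSCrel c)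
        rw [map_mul, map_mul, hι] at h
        rw [hone]
        simpa using h
      map_B := fun b hb => by
        obtain ⟨θ, rfl⟩ := hsL b hb
        rw [← lTensor_sL_assoc_rTensor, hΔE1, hΔE2, lTensor_sL_mul_leg12, hone]
      map_B' := fun b hb => by
        obtain ⟨θ, rfl⟩ := hsL b hb
        rw [← lTensor_sL_assoc_rTensor, hΔE1, lTensor_sL_leg12_mul, hone]
      map_C := fun c hc => by
        obtain ⟨θ, rfl⟩ := hsR c hc
        rw [← rTensor_sR_assoc_symm_lTensor, hΔE, rTensor_sR_leg12_mul, hone]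
      map_C' := fun c hc => by
        obtain ⟨θ, rfl⟩ := hsR c hc
        rw [← rTensor_sR_assoc_symm_lTensor, hΔE, hΔE2, rTensor_sR_mul_leg12, hone]
      exists_dual := by
        obtain ⟨θ, hθ⟩ := hsliceB 1
        refine ⟨θ, ?_⟩
        have h := congrArg SC.symm hθ
        rw [← SC.map_one_of_anti hSCanti, SC.symm_apply_apply, map_sum] at h
        simpa using congrArg (Subtype.val : C → A) h
      faithfulL := hfaithL
      faithfulR := hfaithR }
  obtain ⟨ε, S, hεL, hεR, hbij, hslice, hgal, hproj⟩ := D.exists_counit_antipode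
  have H : IsCanonicalAntipode Δ SB e f ε S := ⟨hεL, hεR, hslice, hgal, hproj⟩
  refine ⟨ε, S, fun a b => ⟨?_, ?_⟩, hbij, H.antipode_mul D, H.comul_antipode D, ?_, ?_⟩
  · rw [sR_mul_one_tmul, hεR]
  · rw [sL_tmul_one_mul, hεL]
  · rw [← hone]
    exact H.mul_antipode_id D
  · rw [← hone]
    exact H.mul_id_antipode
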